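/- Let G = (V,E) be a connected simple graph on n vertices where each edge e has capacity 2k_e (k_e a positive integer) and initial balance k_e on each side, and consider the random payment process: at each round a pair of distinct vertices {s,t} is chosen uniformly at random, one of the shortest s–t paths is chosen uniformly at random, and one unit of balance is moved across every edge of the path in the direction of traversal. Let τ be the first round at which some edge has balance 0 in one of its two directions. Then for every edge e ∈ E, with t̄_e = 4 n(n-1) (k_e²/g(e)) ⌈log₂ n⌉, the probability that τ_e > t̄_e is at most 1/n, where τ_e is the first round at which edge e has balance 0 in one direction and g(e) is the edge-betweenness centrality of e. Consequently, with probability at least 1 − 1/n, τ ≤ 4 n(n-1) ξ ⌈log₂ n⌉ where ξ = min{ k_e²/g(e) : e ∈ E }, i.e. τ = O(ξ n² log n) with high probability. -/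

import Mathlib

open MeasureTheory ProbabilityTheory SimpleGraph Finset
open scoped ENNReal

/-- The `Finset` of shortest `s`–`t` paths in `G`: walks from `s` to `t` of minimal
length (`G.dist s t`) that are paths. -/
noncomputable def shortestPaths {V : Type*} [Fintype V] [DecidableEq V] (G : SimpleGraph V)
    [DecidableRel G.Adj] (s t : V) : Finset (G.Walk s t) :=
  (G.finsetWalkLength (G.dist s t) s t).filter fun p => p.IsPath

/-- `σ(s,t)`: the number of shortest `s`–`t` paths in `G`. -/
noncomputable def numSP {V : Type*} [Fintype V] [DecidableEq V] (G : SimpleGraph V)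
    [DecidableRel G.Adj] (s t : V) : ℕ :=
  (shortestPaths G s t).card

/-- `σ(s,t|e)`: the number of shortest `s`–`t` paths in `G` containing the edge `e`. -/
noncomputable def numSPvia {V : Type*} [Fintype V] [DecidableEq V] (G : SimpleGraph V)
    [DecidableRel G.Adj] (s t : V) (e : Sym2 V) : ℕ :=
  ((shortestPaths G s t).filter fun p => e ∈ p.edges).card

/-- The edge-betweenness centrality `g(e) = Σ_{{s,t} ⊆ V, s ≠ t} σ(s,t|e)/σ(s,t)`,
the sum ranging over unordered pairs of distinct vertices (realized as half the sum
over ordered pairs of distinct vertices). -/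
noncomputable def betweenness {V : Type*} [Fintype V] [DecidableEq V]
    (G : SimpleGraph V) [DecidableRel G.Adj] (e : Sym2 V) : ℝ :=
  (1 / 2) * ∑ s : V, ∑ t : V,
    if s ≠ t then (numSPvia G s t e : ℝ) / (numSP G s t : ℝ) else 0

/-- The net number of times the walk `p` traverses the edge `{u,v}` in the direction
from `u` to `v` (traversals from `u` to `v` minus traversals from `v` to `u`). -/
def netflow {V : Type*} [DecidableEq V] {G : SimpleGraph V} {a b : V}
    (p : G.Walk a b) (u v : V) : ℤ :=
  ((p.darts.filter fun d => d.toProd = (u, v)).length : ℤ) -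
    ((p.darts.filter fun d => d.toProd = (v, u)).length : ℤ)


lemma aux_count {V : Type*} [DecidableEq V] {G : SimpleGraph V} (u v : V) (huv : u ≠ v)
    (l : List G.Dart) :
    (l.filter fun d => d.toProd = (u, v)).length + (l.filter fun d => d.toProd = (v, u)).length
      = (l.map Dart.edge).count s(u, v) := by
  induction l with
  | nil => simp
  | cons d l ih =>
    have hiff : d.edge = s(u, v) ↔ d.toProd = (u, v) ∨ d.toProd = (v, u) :=
      dart_edge_eq_mk'_iff
    have hne : (u, v) ≠ (v, u) := by
      intro h; exact huv (Prod.ext_iff.1 h).1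
    simp only [List.map_cons, List.count_cons, ← ih, List.filter_cons]
    by_cases h1 : d.toProd = (u, v)
    · have h2 : d.toProd ≠ (v, u) := by rw [h1]; exact hne
      have h3 : d.edge = s(u, v) := hiff.2 (Or.inl h1)
      simp [h1, hne, h3]
      omega
    · by_cases h2 : d.toProd = (v, u)
      · have h3 : d.edge = s(u, v) := hiff.2 (Or.inr h2)
        simp [h2, hne.symm, h3]
        omega
      · have h3 : d.edge ≠ s(u, v) := fun h => (hiff.1 h).elim h1 h2
        simp [h1, h2, h3]

lemma netflow_swap {V : Type*} [DecidableEq V] {G : SimpleGraph V} {a b : V}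
    (p : G.Walk a b) (u v : V) : netflow p v u = - netflow p u v := by
  unfold netflow; ring

lemma netflow_reverse {V : Type*} [DecidableEq V] {G : SimpleGraph V} {a b : V}
    (p : G.Walk a b) (u v : V) : netflow p.reverse u v = - netflow p u v := by
  have key : ∀ u v : V, (p.reverse.darts.filter fun d => d.toProd = (u, v)).length
      = (p.darts.filter fun d => d.toProd = (v, u)).length := by
    intro u v
    rw [Walk.darts_reverse, List.filter_reverse, List.length_reverse, List.filter_map,
      List.length_map]
    congr 2
    funext d
    simp only [Function.comp, Dart.symm_toProd, decide_eq_decide]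
    rcases d.toProd with ⟨x, y⟩
    simp [and_comm]
  unfold netflow
  rw [key, key]; ring

lemma netflow_path {V : Type*} [DecidableEq V] {G : SimpleGraph V} {a b : V}
    (p : G.Walk a b) (hp : p.IsPath) (u v : V) (huv : u ≠ v) :
    (netflow p u v = 0 ∧ s(u, v) ∉ p.edges) ∨ (netflow p u v = 1 ∧ s(u, v) ∈ p.edges)
      ∨ (netflow p u v = -1 ∧ s(u, v) ∈ p.edges) := by
  have h := aux_count u v huv p.darts
  have h1 : p.edges.count s(u, v) ≤ 1 := List.nodup_iff_count_le_one.1 hp.isTrail.edges_nodup _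
  change _ = p.edges.count s(u, v) at h
  have h2 := List.count_pos_iff (a := s(u, v)) (l := p.edges)
  unfold netflow
  by_cases hm : s(u, v) ∈ p.edges
  · have := h2.2 hm
    right
    simp only [hm, and_true]
    omega
  · have : p.edges.count s(u, v) = 0 := List.count_eq_zero.2 hm
    left
    refine ⟨?_, hm⟩
    omega

lemma mem_shortestPaths {V : Type*} [Fintype V] [DecidableEq V] (G : SimpleGraph V)
    [DecidableRel G.Adj] {s t : V} (p : G.Walk s t) :
    p ∈ shortestPaths G s t ↔ p.length = G.dist s t ∧ p.IsPath := by
  simp [shortestPaths, mem_finsetWalkLength_iff]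

lemma numSP_pos {V : Type*} [Fintype V] [DecidableEq V] (G : SimpleGraph V)
    [DecidableRel G.Adj] (hG : G.Connected) (s t : V) : 0 < numSP G s t := by
  obtain ⟨p, hp, hl⟩ := hG.exists_path_of_dist s t
  exact Finset.card_pos.2 ⟨p, (mem_shortestPaths G p).2 ⟨hl, hp⟩⟩

/-- number of shortest paths with net flow `c` along `(u,v)`. -/
noncomputable def numFl {V : Type*} [Fintype V] [DecidableEq V] (G : SimpleGraph V)
    [DecidableRel G.Adj] (u v : V) (c : ℤ) (s t : V) : ℕ :=
  ((shortestPaths G s t).filter fun p => netflow p u v = c).card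

noncomputable def sumFl {V : Type*} [Fintype V] [DecidableEq V] (G : SimpleGraph V)
    [DecidableRel G.Adj] (u v : V) (c : ℤ) : ℝ :=
  ∑ s : V, ∑ t : V, if s ≠ t then (numFl G u v c s t : ℝ) / (numSP G s t : ℝ) else 0

lemma numFl_le_reverse {V : Type*} [Fintype V] [DecidableEq V] (G : SimpleGraph V)
    [DecidableRel G.Adj] (u v : V) (c : ℤ) (s t : V) :
    numFl G u v c s t ≤ numFl G u v (-c) t s := by
  unfold numFl
  apply Finset.card_le_card_of_injOn (fun p => p.reverse)
  · intro p hp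
    simp only [Finset.coe_filter, Set.mem_ofPred_eq, mem_shortestPaths] at hp ⊢
    refine ⟨⟨?_, hp.1.2.reverse⟩, ?_⟩
    · rw [Walk.length_reverse, hp.1.1, dist_comm]
    · rw [netflow_reverse, hp.2]
  · intro p _ p' _ h
    exact Walk.reverse_injective h

lemma numSP_le_reverse {V : Type*} [Fintype V] [DecidableEq V] (G : SimpleGraph V)
    [DecidableRel G.Adj] (s t : V) :
    numSP G s t ≤ numSP G t s := by
  unfold numSP
  apply Finset.card_le_card_of_injOn (fun p => p.reverse)
  · intro p hp
    simp only [Finset.mem_coe, mem_shortestPaths] at hp ⊢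
    refine ⟨?_, hp.2.reverse⟩
    rw [Walk.length_reverse, hp.1, dist_comm]
  · intro p _ p' _ h
    exact Walk.reverse_injective h

lemma sumFl_neg {V : Type*} [Fintype V] [DecidableEq V] (G : SimpleGraph V)
    [DecidableRel G.Adj] (u v : V) (c : ℤ) : sumFl G u v (-c) = sumFl G u v c := by
  unfold sumFl
  rw [Finset.sum_comm]
  refine Finset.sum_congr rfl fun s _ => Finset.sum_congr rfl fun t _ => ?_
  have h1 : numFl G u v (-c) t s = numFl G u v c s t := by
    apply le_antisymm
    · simpa using numFl_le_reverse G u v (-c) t s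
    · exact numFl_le_reverse G u v c s t
  have h2 : numSP G t s = numSP G s t := le_antisymm (numSP_le_reverse G t s) (numSP_le_reverse G s t)
  rw [h1, h2]
  simp [ne_comm]

lemma numFl_via {V : Type*} [Fintype V] [DecidableEq V] (G : SimpleGraph V)
    [DecidableRel G.Adj] (u v : V) (huv : u ≠ v) (s t : V) :
    numFl G u v 1 s t + numFl G u v (-1) s t = numSPvia G s t s(u, v) := by
  unfold numFl numSPvia
  rw [← Finset.card_union_of_disjoint, ← Finset.filter_or]
  · congr 1
    apply Finset.filter_congr
    intro p hp
    rcases netflow_path p ((mem_shortestPaths G p).1 hp).2 u v huv with h | h | h <;> simp [h]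
  · rw [Finset.disjoint_filter]
    intro p _ h h'
    omega

lemma numFl_zero {V : Type*} [Fintype V] [DecidableEq V] (G : SimpleGraph V)
    [DecidableRel G.Adj] (u v : V) (huv : u ≠ v) (s t : V) :
    numFl G u v 0 s t + numSPvia G s t s(u, v) = numSP G s t := by
  unfold numFl numSPvia numSP
  rw [← Finset.card_union_of_disjoint, ← Finset.filter_or]
  · congr 1
    apply Finset.filter_true_of_mem
    intro p hp
    rcases netflow_path p ((mem_shortestPaths G p).1 hp).2 u v huv with h | h | h <;> simp [h]
  · rw [Finset.disjoint_filter]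
    intro p hp h h'
    rcases netflow_path p ((mem_shortestPaths G p).1 hp).2 u v huv with h1 | h1 | h1
    · exact h1.2 h'
    · omega
    · omega

lemma sumFl_one {V : Type*} [Fintype V] [DecidableEq V] (G : SimpleGraph V)
    [DecidableRel G.Adj] (u v : V) (huv : u ≠ v) :
    sumFl G u v 1 = betweenness G s(u, v) := by
  have h : sumFl G u v 1 + sumFl G u v (-1) = 2 * betweenness G s(u, v) := by
    unfold sumFl betweenness
    rw [← Finset.sum_add_distrib, ← mul_assoc]
    norm_num only [one_mul]
    refine Finset.sum_congr rfl fun s _ => ?_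
    rw [← Finset.sum_add_distrib]
    refine Finset.sum_congr rfl fun t _ => ?_
    rw [← numFl_via G u v huv]
    split_ifs
    · push_cast; ring
    · simp
  rw [sumFl_neg] at h
  linarith

lemma sumFl_zero {V : Type*} [Fintype V] [DecidableEq V] (G : SimpleGraph V)
    [DecidableRel G.Adj] (hG : G.Connected) (u v : V) (huv : u ≠ v) :
    sumFl G u v 0 = (Fintype.card V : ℝ) * ((Fintype.card V : ℝ) - 1)
      - 2 * betweenness G s(u, v) := by
  have h : sumFl G u v 0 + 2 * betweenness G s(u, v)
      = ∑ s : V, ∑ t : V, if s ≠ t then (1 : ℝ) else 0 := by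
    unfold sumFl betweenness
    rw [← mul_assoc]
    norm_num only [one_mul]
    rw [← Finset.sum_add_distrib]
    refine Finset.sum_congr rfl fun s _ => ?_
    rw [← Finset.sum_add_distrib]
    refine Finset.sum_congr rfl fun t _ => ?_
    split_ifs
    · rw [← add_div, ← Nat.cast_add, numFl_zero G u v huv, div_self]
      exact_mod_cast (numSP_pos G hG s t).ne'
    · simp
  have h2 : ∑ s : V, ∑ t : V, (if s ≠ t then (1 : ℝ) else 0)
      = (Fintype.card V : ℝ) * ((Fintype.card V : ℝ) - 1) := by
    have : ∀ s : V, ∑ t : V, (if s ≠ t then (1 : ℝ) else 0) = (Fintype.card V : ℝ) - 1 := by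
      intro s
      have : ∀ t : V, (if s ≠ t then (1 : ℝ) else 0) = 1 - if s = t then 1 else 0 := by
        intro t; split_ifs <;> simp_all
      simp only [this, Finset.sum_sub_distrib]
      simp
    simp only [this]
    simp
    ring
  linarith

lemma betweenness_pos {V : Type*} [Fintype V] [DecidableEq V] (G : SimpleGraph V)
    [DecidableRel G.Adj] (hG : G.Connected) (u v : V) (huv : G.Adj u v) :
    0 < betweenness G s(u, v) := by
  unfold betweenness
  apply mul_pos (by norm_num)
  have nn : ∀ s t : V, 0 ≤ if s ≠ t then (numSPvia G s t s(u, v) : ℝ) / (numSP G s t : ℝ) else 0 := by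
    intro s t; split_ifs <;> positivity
  apply Finset.sum_pos' (fun s _ => Finset.sum_nonneg fun t _ => nn s t)
  refine ⟨u, Finset.mem_univ _, ?_⟩
  apply Finset.sum_pos' (fun t _ => nn u t)
  refine ⟨v, Finset.mem_univ _, ?_⟩
  rw [if_pos huv.ne]
  have h1 := numSP_pos G hG u v
  have h2 : 0 < numSPvia G u v s(u, v) := by
    unfold numSPvia
    refine Finset.card_pos.2 ⟨huv.toWalk, ?_⟩
    simp [mem_shortestPaths, dist_eq_one_iff_adj.2 huv, huv.ne]
  positivity

lemma survive_bound {Ω α : Type*} [MeasurableSpace Ω] (μ : Measure Ω) [IsProbabilityMeasure μ]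
    (W : ℕ → Ω → α) (hind : iIndepFun (m := fun _ => ⊤) W μ) (f : α → ℤ) (q : ℝ)
    (hq0 : 0 ≤ q) (hq1 : q ≤ 1) (k : ℕ) (hk : 1 ≤ k)
    (h1 : ∀ t, μ.real (W t ⁻¹' {a | f a = 1}) ≤ q / 2)
    (h2 : ∀ t, μ.real (W t ⁻¹' {a | f a = -1}) ≤ q / 2)
    (h0 : ∀ t, μ.real (W t ⁻¹' {a | f a = 0}) ≤ 1 - q)
    (hoth : ∀ t, μ.real (W t ⁻¹' {a | f a ≠ 0 ∧ f a ≠ 1 ∧ f a ≠ -1}) = 0)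
    (T : ℕ) : ∀ (s : ℕ) (x : ℤ) (_ : |x| ≤ k) (A : ℕ → Set α),
      μ.real ((⋂ i ∈ Finset.range s, W i ⁻¹' A i) ∩
        {ω | ∀ j ≤ T, |x + ∑ i ∈ Finset.range j, f (W (s + i) ω)| ≠ k})
      ≤ μ.real (⋂ i ∈ Finset.range s, W i ⁻¹' A i) *
        ((1 - q / (2 * k ^ 2)) ^ T * ((2 * k ^ 2 - x ^ 2) / k ^ 2)) := by
  have hkR : (1 : ℝ) ≤ k := by exact_mod_cast hk
  have hk2 : (1 : ℝ) ≤ (k : ℝ) ^ 2 := one_le_pow₀ hkR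
  have hlam : 0 ≤ 1 - q / (2 * (k : ℝ) ^ 2) := by
    rw [sub_nonneg, div_le_one (by positivity)]; linarith
  have hsq : ∀ x : ℤ, |x| ≤ k → (x : ℝ) ^ 2 ≤ (k : ℝ) ^ 2 := by
    intro x hx
    have : |(x : ℝ)| ≤ (k : ℝ) := by exact_mod_cast hx
    exact sq_le_sq' (by linarith [neg_abs_le (x : ℝ)]) (le_trans (le_abs_self _) this)
  induction T with
  | zero =>
    intro s x hx A
    have := hsq x hx
    refine (measureReal_mono Set.inter_subset_left).trans ?_
    refine le_mul_of_one_le_right measureReal_nonneg ?_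
    rw [pow_zero, one_mul, one_le_div (by positivity)]
    linarith
  | succ T ih =>
    intro s x hx A
    set C := ⋂ i ∈ Finset.range s, W i ⁻¹' A i with hC
    have hsx := hsq x hx
    by_cases hxk : |x| = k
    · have hempty : C ∩ {ω | ∀ j ≤ T + 1,
          |x + ∑ i ∈ Finset.range j, f (W (s + i) ω)| ≠ k} = ∅ := by
        ext ω
        simp only [Set.mem_inter_iff, Set.mem_ofPred_eq, Set.mem_empty_iff_false, iff_false, not_and]
        intro _ h
        exact h 0 (Nat.zero_le _) (by simpa using hxk)
      rw [hempty, measureReal_empty]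
      have : 0 ≤ (2 * (k : ℝ) ^ 2 - (x : ℝ) ^ 2) := by linarith
      positivity
    · have hlt : |x| < k := lt_of_le_of_ne hx hxk
      have hpre : ∀ B : Set α, (⋂ i ∈ Finset.range (s + 1), W i ⁻¹' (Function.update A s B) i)
          = C ∩ W s ⁻¹' B := by
        intro B
        rw [Finset.range_add_one, Finset.set_biInter_insert, Set.inter_comm]
        simp only [Function.update_self]
        congr 1
        refine Set.iInter₂_congr fun i hi => ?_
        rw [Function.update_of_ne (Finset.mem_range.1 hi).ne]
      have hprod : ∀ B : Set α, μ.real (C ∩ W s ⁻¹' B) = μ.real C * μ.real (W s ⁻¹' B) := by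
        intro B
        have e1 := hind.measure_inter_preimage_eq_mul (Finset.range (s + 1))
          (sets := Function.update A s B) (fun _ _ => trivial)
        have e2 := hind.measure_inter_preimage_eq_mul (Finset.range s)
          (sets := A) (fun _ _ => trivial)
        rw [hpre, Finset.prod_range_succ, Function.update_self] at e1
        have e3 : ∏ i ∈ Finset.range s, μ (W i ⁻¹' (Function.update A s B) i)
            = ∏ i ∈ Finset.range s, μ (W i ⁻¹' A i) := by
          refine Finset.prod_congr rfl fun i hi => ?_
          rw [Function.update_of_ne (Finset.mem_range.1 hi).ne]
        rw [e3, ← e2] at e1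
        rw [Measure.real, e1, ENNReal.toReal_mul]
        rfl
      have hstep : ∀ (e : ℤ) (r : ℝ), |x + e| ≤ k → μ.real (W s ⁻¹' {a | f a = e}) ≤ r →
          μ.real ((C ∩ W s ⁻¹' {a | f a = e}) ∩
            {ω | ∀ j ≤ T, |(x + e) + ∑ i ∈ Finset.range j, f (W (s + 1 + i) ω)| ≠ k})
          ≤ μ.real C * (r * ((1 - q / (2 * k ^ 2)) ^ T *
              ((2 * k ^ 2 - (x + e) ^ 2) / k ^ 2))) := by
        intro e r hxe hr
        have := ih (s + 1) (x + e) hxe (Function.update A s {a | f a = e})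
        rw [hpre, hprod, mul_assoc] at this
        push_cast at this
        refine this.trans ?_
        have hs := hsq _ hxe
        push_cast at hs
        have : 0 ≤ (2 * (k : ℝ) ^ 2 - ((x : ℝ) + e) ^ 2) := by linarith
        gcongr
      have b1 := hstep 1 (q / 2) (by rw [abs_le]; rw [abs_lt] at hlt; omega) (h1 s)
      have b2 := hstep (-1) (q / 2) (by rw [abs_le]; rw [abs_lt] at hlt; omega) (h2 s)
      have b0 := hstep 0 (1 - q) (by simpa using hx) (h0 s)
      have hsub : C ∩ {ω | ∀ j ≤ T + 1, |x + ∑ i ∈ Finset.range j, f (W (s + i) ω)| ≠ k}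
          ⊆ (((C ∩ W s ⁻¹' {a | f a = 1}) ∩
            {ω | ∀ j ≤ T, |(x + 1) + ∑ i ∈ Finset.range j, f (W (s + 1 + i) ω)| ≠ k}) ∪
            ((C ∩ W s ⁻¹' {a | f a = -1}) ∩
            {ω | ∀ j ≤ T, |(x + -1) + ∑ i ∈ Finset.range j, f (W (s + 1 + i) ω)| ≠ k})) ∪
            (((C ∩ W s ⁻¹' {a | f a = 0}) ∩
            {ω | ∀ j ≤ T, |(x + 0) + ∑ i ∈ Finset.range j, f (W (s + 1 + i) ω)| ≠ k}) ∪
            W s ⁻¹' {a | f a ≠ 0 ∧ f a ≠ 1 ∧ f a ≠ -1}) := by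
        rintro ω ⟨hω, hs⟩
        have key : ∀ e : ℤ, f (W s ω) = e →
            ∀ j ≤ T, |(x + e) + ∑ i ∈ Finset.range j, f (W (s + 1 + i) ω)| ≠ k := by
          intro e he j hj
          have := hs (j + 1) (by omega)
          rw [Finset.sum_range_succ'] at this
          simp only [add_zero, he] at this
          have hsum : ∑ i ∈ Finset.range j, f (W (s + 1 + i) ω)
              = ∑ i ∈ Finset.range j, f (W (s + (i + 1)) ω) := by
            refine Finset.sum_congr rfl fun i _ => ?_
            rw [show s + 1 + i = s + (i + 1) by ring]
          rw [hsum, add_assoc, add_comm e]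
          exact this
        by_cases c1 : f (W s ω) = 1
        · exact Or.inl (Or.inl ⟨⟨hω, c1⟩, key 1 c1⟩)
        by_cases c2 : f (W s ω) = -1
        · exact Or.inl (Or.inr ⟨⟨hω, c2⟩, key (-1) c2⟩)
        by_cases c0 : f (W s ω) = 0
        · exact Or.inr (Or.inl ⟨⟨hω, c0⟩, key 0 c0⟩)
        exact Or.inr (Or.inr ⟨c0, c1, c2⟩)
      refine (measureReal_mono hsub).trans ?_
      refine (measureReal_union_le _ _).trans ?_
      refine (add_le_add (measureReal_union_le _ _) (measureReal_union_le _ _)).trans ?_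
      rw [hoth s]
      refine (add_le_add (add_le_add b1 b2) (add_le_add b0 le_rfl)).trans ?_
      rw [add_zero, ← mul_add, ← mul_add]
      refine mul_le_mul_of_nonneg_left ?_ measureReal_nonneg
      have hL := pow_nonneg hlam T
      set L := (1 - q / (2 * (k : ℝ) ^ 2)) ^ T with hLdef
      have e1 : q / 2 * (L * ((2 * (k : ℝ) ^ 2 - (x + (1 : ℤ)) ^ 2) / k ^ 2)) +
          q / 2 * (L * ((2 * (k : ℝ) ^ 2 - (x + (-1 : ℤ)) ^ 2) / k ^ 2)) +
          (1 - q) * (L * ((2 * (k : ℝ) ^ 2 - (x + (0 : ℤ)) ^ 2) / k ^ 2))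
          = L * ((2 * (k : ℝ) ^ 2 - x ^ 2 - q) / k ^ 2) := by
        push_cast; field_simp; ring
      rw [e1, pow_succ _ T, ← hLdef, mul_assoc]
      refine mul_le_mul_of_nonneg_left ?_ hL
      rw [← mul_div_assoc]
      refine div_le_div_of_nonneg_right ?_ (by positivity)
      have : q / (2 * (k : ℝ) ^ 2) * (2 * k ^ 2 - x ^ 2) ≤ q := by
        calc q / (2 * (k : ℝ) ^ 2) * (2 * k ^ 2 - x ^ 2) ≤ q / (2 * (k : ℝ) ^ 2) * (2 * k ^ 2) := by
              gcongr; linarith [sq_nonneg (x : ℝ)]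
          _ = q := by field_simp
      linarith

lemma numeric_bound (q : ℝ) (hq0 : 0 < q) (hq1 : q ≤ 1) (k : ℕ) (hk : 1 ≤ k) (n : ℕ) (hn2 : 2 ≤ n)
    (B : ℝ) (hB : B = 8 * k ^ 2 / q * (⌈Real.logb 2 n⌉₊ : ℝ)) :
    (1 - q / (2 * (k : ℝ) ^ 2)) ^ ⌊B⌋₊ * 2 ≤ 1 / (n : ℝ) := by
  have hkR : (1 : ℝ) ≤ k := by exact_mod_cast hk
  have hk2 : (1 : ℝ) ≤ (k : ℝ) ^ 2 := one_le_pow₀ hkR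
  have hlam : 0 ≤ 1 - q / (2 * (k : ℝ) ^ 2) := by
    rw [sub_nonneg, div_le_one (by positivity)]; linarith
  have hn0 : (0 : ℝ) < n := by positivity
  set L := ⌈Real.logb 2 n⌉₊ with hL
  have hnL : Real.log n ≤ L := by
    have h1 : Real.logb 2 n ≤ L := Nat.le_ceil _
    rw [Real.logb, div_le_iff₀ (Real.log_pos (by norm_num))] at h1
    have : Real.log 2 ≤ 1 := by linarith [Real.log_two_lt_d9]
    nlinarith [Nat.cast_nonneg (α := ℝ) L]
  have hL1 : (1 : ℝ) ≤ L := by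
    have : 0 < L := Nat.ceil_pos.2 (Real.logb_pos (by norm_num) (by exact_mod_cast hn2))
    exact_mod_cast this
  have hfl : B - 1 ≤ (⌊B⌋₊ : ℝ) := by linarith [Nat.lt_floor_add_one B]
  have hexp : (1 - q / (2 * (k : ℝ) ^ 2)) ^ ⌊B⌋₊ ≤ Real.exp (-(q / (2 * (k : ℝ) ^ 2)) * ⌊B⌋₊) := by
    rw [mul_comm _ (⌊B⌋₊ : ℝ), Real.exp_nat_mul]
    apply pow_le_pow_left₀ hlam
    linarith [Real.add_one_le_exp (-(q / (2 * (k : ℝ) ^ 2)))]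
  have hE : -(q / (2 * (k : ℝ) ^ 2)) * ⌊B⌋₊ ≤ 1 / 2 - 4 * L := by
    have hc : 0 ≤ q / (2 * (k : ℝ) ^ 2) := by positivity
    have h3 := mul_le_mul_of_nonneg_left hfl hc
    have h4 : q / (2 * (k : ℝ) ^ 2) * (B - 1) = 4 * L - q / (2 * (k : ℝ) ^ 2) := by
      rw [hB]; field_simp
      ring
    have h5 : q / (2 * (k : ℝ) ^ 2) ≤ 1 / 2 := by
      rw [div_le_div_iff₀ (by positivity) (by norm_num)]; linarith
    linarith
  have h2e : (2 : ℝ) ≤ Real.exp 1 := by linarith [Real.add_one_le_exp (1 : ℝ)]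
  calc (1 - q / (2 * (k : ℝ) ^ 2)) ^ ⌊B⌋₊ * 2
      ≤ Real.exp (1 / 2 - 4 * L) * Real.exp 1 := by
        gcongr
        exact hexp.trans (Real.exp_le_exp.2 hE)
    _ = Real.exp (3 / 2 - 4 * L) := by rw [← Real.exp_add]; congr 1; ring
    _ ≤ Real.exp (- Real.log n) := Real.exp_le_exp.2 (by linarith)
    _ = 1 / n := by rw [Real.exp_neg, Real.exp_log hn0, one_div]

lemma law_null {V : Type*} [Fintype V] [DecidableEq V] (G : SimpleGraph V) [DecidableRel G.Adj]
    {Ω : Type*} [MeasurableSpace Ω] (μ : Measure Ω)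
    (X : Ω → Σ st : V × V, G.Walk st.1 st.2) (m : V × V → ℝ≥0∞)
    (hX : ∀ (st : V × V) (p : G.Walk st.1 st.2),
      μ {ω | X ω = ⟨st, p⟩} =
        if st.1 ≠ st.2 ∧ p ∈ shortestPaths G st.1 st.2 then m st else 0) :
    μ {ω | ¬ ((X ω).1.1 ≠ (X ω).1.2 ∧ (X ω).2 ∈ shortestPaths G (X ω).1.1 (X ω).1.2)} = 0 := by
  have : ∀ st : V × V, Countable (G.Walk st.1 st.2) := fun st =>
    (Walk.support_injective (G := G) (u := st.1) (v := st.2)).countable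
  have hsub : {ω | ¬ ((X ω).1.1 ≠ (X ω).1.2 ∧ (X ω).2 ∈ shortestPaths G (X ω).1.1 (X ω).1.2)}
      ⊆ ⋃ a : {a : Σ st : V × V, G.Walk st.1 st.2 //
        ¬ (a.1.1 ≠ a.1.2 ∧ a.2 ∈ shortestPaths G a.1.1 a.1.2)}, {ω | X ω = a.1} := by
    intro ω hω
    exact Set.mem_iUnion.2 ⟨⟨X ω, hω⟩, rfl⟩
  refine measure_mono_null hsub (measure_iUnion_null ?_)
  rintro ⟨⟨st, p⟩, ha⟩
  rw [hX st p, if_neg ha]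

lemma law_bound {V : Type*} [Fintype V] [DecidableEq V] (G : SimpleGraph V) [DecidableRel G.Adj]
    {Ω : Type*} [MeasurableSpace Ω] (μ : Measure Ω) [IsProbabilityMeasure μ] (N : ℝ) (hN : 0 < N)
    (X : Ω → Σ st : V × V, G.Walk st.1 st.2)
    (hX : ∀ (st : V × V) (p : G.Walk st.1 st.2),
      μ {ω | X ω = ⟨st, p⟩} =
        if st.1 ≠ st.2 ∧ p ∈ shortestPaths G st.1 st.2 then
          ENNReal.ofReal ((1 / N) * (1 / (numSP G st.1 st.2 : ℝ))) else 0)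
    (u v : V) (c : ℤ) :
    μ.real (X ⁻¹' {a | netflow a.2 u v = c}) ≤ sumFl G u v c / N := by
  classical
  have hnull := law_null G μ X _ hX
  set F : Finset (Σ st : V × V, G.Walk st.1 st.2) :=
    (Finset.univ.filter fun st : V × V => st.1 ≠ st.2).sigma
      (fun st => (shortestPaths G st.1 st.2).filter fun p => netflow p u v = c) with hF
  have hsub : X ⁻¹' {a | netflow a.2 u v = c} ⊆ (⋃ a ∈ F, {ω | X ω = a}) ∪
      {ω | ¬ ((X ω).1.1 ≠ (X ω).1.2 ∧ (X ω).2 ∈ shortestPaths G (X ω).1.1 (X ω).1.2)} := by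
    intro ω hω
    by_cases h : (X ω).1.1 ≠ (X ω).1.2 ∧ (X ω).2 ∈ shortestPaths G (X ω).1.1 (X ω).1.2
    · left
      refine Set.mem_iUnion₂.2 ⟨X ω, ?_, rfl⟩
      rw [hF, Finset.mem_sigma, Finset.mem_filter, Finset.mem_filter]
      exact ⟨⟨Finset.mem_univ _, h.1⟩, h.2, hω⟩
    · right; exact h
  refine (measureReal_mono hsub).trans ((measureReal_union_le _ _).trans ?_)
  rw [(measureReal_eq_zero_iff).2 hnull, add_zero]
  refine (measureReal_biUnion_finset_le _ _).trans ?_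
  rw [hF, Finset.sum_sigma]
  have hin : ∀ st ∈ (Finset.univ.filter fun st : V × V => st.1 ≠ st.2),
      ∑ p ∈ (shortestPaths G st.1 st.2).filter (fun p => netflow p u v = c),
        μ.real {ω | X ω = ⟨st, p⟩}
      = (numFl G u v c st.1 st.2 : ℝ) / (numSP G st.1 st.2 : ℝ) / N := by
    intro st hst
    rw [Finset.mem_filter] at hst
    have : ∀ p ∈ (shortestPaths G st.1 st.2).filter (fun p => netflow p u v = c),
        μ.real {ω | X ω = ⟨st, p⟩} = (1 / N) * (1 / (numSP G st.1 st.2 : ℝ)) := by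
      intro p hp
      rw [Measure.real, hX, if_pos ⟨hst.2, (Finset.mem_filter.1 hp).1⟩, ENNReal.toReal_ofReal]
      positivity
    rw [Finset.sum_congr rfl this, Finset.sum_const, nsmul_eq_mul]
    change (numFl G u v c st.1 st.2 : ℝ) * _ = _
    ring
  rw [Finset.sum_congr rfl hin, ← Finset.sum_div, Finset.sum_filter, Fintype.sum_prod_type]
  rfl

/-- **Upper bound on the first failure time of the random payment process.**
Each edge `e` of the connected graph `G` has capacity `2·kcap e` and initial balance
`kcap e` on each side (`bal t ω u v` is the balance on `u`'s side of the edge `{u,v}`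
after `t` rounds).  At each round an ordered pair of distinct vertices is chosen
uniformly at random (equivalently, an unordered pair `{s,t}` uniformly at random), a
shortest path between them is chosen uniformly at random (this is the choice `W t`),
and one unit of balance moves across every edge of the path in the direction of
traversal.  For an edge `{u,v}`, `τe` is the first round at which the edge is empty in
one of its two directions, and `τ` is the first round at which some edge is empty in
one direction.  Then for every edge `{u,v}`, with `t̄_e = 4n(n-1)·(kcap e²/g(e))·⌈log₂ n⌉`,
the probability that `τe > t̄_e` is at most `1/n`; consequently, with probability at
least `1 − 1/n`, `τ ≤ 4n(n-1)·ξ·⌈log₂ n⌉`, where `ξ = min{ kcap e²/g(e) : e ∈ E }`,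
i.e. `τ = O(ξ n² log n)` with high probability. -/
theorem payment_process_failure_time_upper_bound
    {V : Type*} [Fintype V] [DecidableEq V] (G : SimpleGraph V) [DecidableRel G.Adj]
    (hG : G.Connected) (n : ℕ) (hn : n = Fintype.card V) (hn2 : 2 ≤ n)
    (kcap : Sym2 V → ℕ) (hkcap : ∀ e ∈ G.edgeSet, 1 ≤ kcap e)
    {Ω : Type*} [MeasurableSpace Ω] (μ : Measure Ω) [IsProbabilityMeasure μ]
    (W : ℕ → Ω → Σ st : V × V, G.Walk st.1 st.2)
    (hWindep : iIndepFun (m := fun _ => ⊤) W μ)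
    (hWdist : ∀ (t : ℕ) (st : V × V) (p : G.Walk st.1 st.2),
      μ {ω | W t ω = ⟨st, p⟩} =
        if st.1 ≠ st.2 ∧ p ∈ shortestPaths G st.1 st.2 then
          ENNReal.ofReal ((1 / ((n : ℝ) * ((n : ℝ) - 1))) * (1 / (numSP G st.1 st.2 : ℝ)))
        else 0)
    (bal : ℕ → Ω → V → V → ℤ)
    (hbal0 : ∀ ω u v, bal 0 ω u v = (kcap s(u, v) : ℤ))
    (hbalstep : ∀ t ω u v, bal (t + 1) ω u v = bal t ω u v - netflow (W t ω).2 u v)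
    (τ : Ω → ℕ∞)
    (hτ : ∀ ω, τ ω =
      sInf (Nat.cast '' {t : ℕ | ∃ u v, G.Adj u v ∧ bal t ω u v = 0}))
    (ξ : ℝ)
    (hξ : ξ = sInf {x : ℝ | ∃ e ∈ G.edgeSet, x = (kcap e : ℝ) ^ 2 / betweenness G e}) :
    (∀ u v, G.Adj u v → ∀ τe : Ω → ℕ∞,
      (∀ ω, τe ω = sInf (Nat.cast '' {t : ℕ | bal t ω u v = 0 ∨ bal t ω v u = 0})) →
      μ {ω | ENNReal.ofReal ((4 : ℝ) * n * ((n : ℝ) - 1) *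
              ((kcap s(u, v) : ℝ) ^ 2 / betweenness G s(u, v)) *
              (⌈Real.logb 2 n⌉₊ : ℝ)) < (τe ω : ℝ≥0∞)} ≤ 1 / (n : ℝ≥0∞)) ∧
    1 - 1 / (n : ℝ≥0∞) ≤
      μ {ω | (τ ω : ℝ≥0∞) ≤
        ENNReal.ofReal ((4 : ℝ) * n * ((n : ℝ) - 1) * ξ * (⌈Real.logb 2 n⌉₊ : ℝ))} := by
  have hcard : (Fintype.card V : ℝ) = n := by rw [hn]
  have hnR : (2 : ℝ) ≤ n := by exact_mod_cast hn2
  have hN : 0 < (n : ℝ) * ((n : ℝ) - 1) := mul_pos (by linarith) (by linarith)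
  have main : ∀ u v, G.Adj u v → ∀ τe : Ω → ℕ∞,
      (∀ ω, τe ω = sInf (Nat.cast '' {t : ℕ | bal t ω u v = 0 ∨ bal t ω v u = 0})) →
      μ {ω | ENNReal.ofReal ((4 : ℝ) * n * ((n : ℝ) - 1) *
              ((kcap s(u, v) : ℝ) ^ 2 / betweenness G s(u, v)) *
              (⌈Real.logb 2 n⌉₊ : ℝ)) < (τe ω : ℝ≥0∞)} ≤ 1 / (n : ℝ≥0∞) := by
    intro u v huv τe hτe
    have hg := betweenness_pos G hG u v huv
    have hk : 1 ≤ kcap s(u, v) := hkcap _ huv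
    set k := kcap s(u, v) with hkdef
    set g := betweenness G s(u, v) with hgdef
    set q : ℝ := 2 * g / (n * ((n : ℝ) - 1)) with hq
    have hq0 : 0 < q := by positivity
    have s0 := sumFl_zero G hG u v huv.ne
    have s1 := sumFl_one G u v huv.ne
    have s2 := sumFl_neg G u v 1
    rw [hcard, ← hgdef] at s0
    have hs0 : 0 ≤ sumFl G u v 0 := by
      unfold sumFl
      refine Finset.sum_nonneg fun s _ => Finset.sum_nonneg fun t _ => ?_
      split_ifs <;> positivity
    have hq1 : q ≤ 1 := by
      rw [hq, div_le_one hN]; linarith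
    have hb := fun t => law_bound G μ _ hN (W t) (hWdist t) u v
    have h1 : ∀ t, μ.real (W t ⁻¹' {a | netflow a.2 u v = 1}) ≤ q / 2 := by
      intro t
      refine (hb t 1).trans_eq ?_
      rw [s1, hq]; ring
    have h2 : ∀ t, μ.real (W t ⁻¹' {a | netflow a.2 u v = -1}) ≤ q / 2 := by
      intro t
      refine (hb t (-1)).trans_eq ?_
      rw [s2, s1, hq]; ring
    have h0 : ∀ t, μ.real (W t ⁻¹' {a | netflow a.2 u v = 0}) ≤ 1 - q := by
      intro t
      refine (hb t 0).trans_eq ?_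
      rw [s0, hq, sub_div, div_self hN.ne']
    have hoth : ∀ t, μ.real (W t ⁻¹' {a | netflow a.2 u v ≠ 0 ∧ netflow a.2 u v ≠ 1
        ∧ netflow a.2 u v ≠ -1}) = 0 := by
      intro t
      rw [Measure.real, measure_mono_null ?_ (law_null G μ (W t) _ (hWdist t)),
        ENNReal.toReal_zero]
      rintro ω ⟨a0, a1, a2⟩ ⟨_, hp⟩
      rcases netflow_path _ ((mem_shortestPaths G _).1 hp).2 u v huv.ne with h | h | h
      · exact a0 h.1
      · exact a1 h.1
      · exact a2 h.1
    set B : ℝ := (4 : ℝ) * n * ((n : ℝ) - 1) * ((k : ℝ) ^ 2 / g) *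
              (⌈Real.logb 2 n⌉₊ : ℝ) with hB
    have hB0 : 0 ≤ B := by
      have : 0 ≤ (n : ℝ) - 1 := by linarith
      positivity
    have hB' : B = 8 * k ^ 2 / q * (⌈Real.logb 2 n⌉₊ : ℝ) := by
      have : (n : ℝ) - 1 ≠ 0 := by linarith
      rw [hB, hq]; field_simp; ring
    have hsurv := survive_bound μ W hWindep (fun a => netflow a.2 u v) q hq0.le hq1 k hk
      h1 h2 h0 hoth ⌊B⌋₊ 0 0 (by simp) (fun _ => Set.univ)
    have hnum := numeric_bound q hq0 hq1 k hk n hn2 B hB'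
    have hbal : ∀ t ω, bal t ω u v = k - ∑ i ∈ Finset.range t, netflow (W i ω).2 u v ∧
        bal t ω v u = k + ∑ i ∈ Finset.range t, netflow (W i ω).2 u v := by
      intro t ω
      induction t with
      | zero => simp [hbal0, hkdef, Sym2.eq_swap]
      | succ t ih =>
        rw [hbalstep, hbalstep, ih.1, ih.2, Finset.sum_range_succ, netflow_swap _ u v]
        constructor <;> ring
    have hsub : {ω | ENNReal.ofReal B < (τe ω : ℝ≥0∞)} ⊆
        {ω | ∀ j ≤ ⌊B⌋₊, |∑ i ∈ Finset.range j, netflow (W i ω).2 u v| ≠ k} := by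
      intro ω hω j hj hjk
      have hmem : j ∈ {t : ℕ | bal t ω u v = 0 ∨ bal t ω v u = 0} := by
        have hb := hbal j ω
        change bal j ω u v = 0 ∨ bal j ω v u = 0
        rcases abs_eq (by positivity : (0 : ℤ) ≤ k) |>.1 hjk with h | h
        · left; rw [hb.1, h]; ring
        · right; rw [hb.2, h]; ring
      have hle : τe ω ≤ (j : ℕ∞) := by
        rw [hτe ω]
        exact sInf_le ⟨j, hmem, rfl⟩
      have hle2 : (τe ω : ℝ≥0∞) ≤ ((j : ℕ∞) : ℝ≥0∞) := ENat.toENNReal_le.2 hle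
      have hle3 : ((j : ℕ∞) : ℝ≥0∞) ≤ ENNReal.ofReal B := by
        rw [ENat.toENNReal_coe, ← ENNReal.ofReal_natCast]
        exact ENNReal.ofReal_le_ofReal ((Nat.cast_le.2 hj).trans (Nat.floor_le hB0))
      exact absurd hω (not_lt.2 (hle2.trans hle3))
    have hfin : μ.real {ω | ENNReal.ofReal B < (τe ω : ℝ≥0∞)} ≤ 1 / n := by
      refine (measureReal_mono hsub).trans (le_trans ?_ hnum)
      have hk0 : (k : ℝ) ^ 2 ≠ 0 := by positivity
      have hz : ∀ i ω, netflow (W (0 + i) ω).2 u v = netflow (W i ω).2 u v := by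
        intro i ω; rw [Nat.zero_add]
      simp only [hz, Finset.range_zero, Finset.notMem_empty, Set.iInter_of_empty, Set.iInter_univ,
        Set.univ_inter, zero_add, probReal_univ, one_mul, Int.cast_zero] at hsurv
      refine hsurv.trans_eq ?_
      congr 1
      field_simp
      ring
    rw [← ENNReal.ofReal_toReal (measure_ne_top μ _)]
    refine (ENNReal.ofReal_le_ofReal hfin).trans_eq ?_
    rw [ENNReal.ofReal_div_of_pos (by linarith), ENNReal.ofReal_one, ENNReal.ofReal_natCast]
  refine ⟨main, ?_⟩
  -- the minimum is attained
  have hfinite : {x : ℝ | ∃ e ∈ G.edgeSet, x = (kcap e : ℝ) ^ 2 / betweenness G e}.Finite := by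
    refine (Set.finite_range fun e : Sym2 V => (kcap e : ℝ) ^ 2 / betweenness G e).subset ?_
    rintro x ⟨e, _, rfl⟩
    exact ⟨e, rfl⟩
  have hne : {x : ℝ | ∃ e ∈ G.edgeSet, x = (kcap e : ℝ) ^ 2 / betweenness G e}.Nonempty := by
    have : Nontrivial V := Fintype.one_lt_card_iff_nontrivial.1 (by omega)
    obtain ⟨u⟩ := hG.nonempty
    obtain ⟨v, hv⟩ := hG.preconnected.exists_adj_of_nontrivial u
    exact ⟨_, s(u, v), hv, rfl⟩
  have hmin := hne.csInf_mem hfinite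
  rw [← hξ] at hmin
  obtain ⟨e, he, hξe⟩ := hmin
  induction e using Sym2.ind with
  | _ u v =>
    have hm := main u v he _ (fun ω => rfl)
    rw [← hξe] at hm
    set b := ENNReal.ofReal ((4 : ℝ) * n * ((n : ℝ) - 1) * ξ * (⌈Real.logb 2 n⌉₊ : ℝ)) with hb
    set S := {ω | (τ ω : ℝ≥0∞) ≤ b} with hS
    have hc : μ Sᶜ ≤ 1 / (n : ℝ≥0∞) := by
      refine (measure_mono ?_).trans hm
      intro ω hω
      have hlt : b < (τ ω : ℝ≥0∞) := not_le.1 hω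
      refine lt_of_lt_of_le hlt (ENat.toENNReal_le.2 ?_)
      rw [hτ ω]
      apply sInf_le_sInf
      apply Set.image_mono
      rintro t (h | h)
      · exact ⟨u, v, he, h⟩
      · exact ⟨v, u, G.adj_symm he, h⟩
    have h1 : (1 : ℝ≥0∞) ≤ μ S + μ Sᶜ := by
      rw [← measure_univ (μ := μ), ← Set.union_compl_self S]
      exact measure_union_le _ _
    refine tsub_le_iff_right.2 (h1.trans ?_)
    gcongr
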